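/- Suppose s ∈ ℤ with s ≥ 2 and u, v ∈ C₀^∞(ℝ³). Then ‖uv‖_{R^s} ≲ ‖u‖_{R^s} ‖v‖_{R^s}, where ‖f‖_{R^s} = ‖Df‖_{H^{s-1}} + ‖f‖_{L^6}. -/

import Mathlib

open MeasureTheory
open scoped ENNReal NNReal

/-- The `R^s` norm on `ℝ³`: `‖f‖_{R^s} = ‖Df‖_{H^{s-1}} + ‖f‖_{L^6}`, where
`‖Df‖_{H^{s-1}}` is the sum of the `L²` norms of the derivatives of `f` of orders `1,…,s`. -/
noncomputable def RNorm (s : ℕ) {F : Type*} [NormedAddCommGroup F] [NormedSpace ℝ F]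
    (f : EuclideanSpace ℝ (Fin 3) → F) : ℝ≥0∞ :=
  (∑ k ∈ Finset.Icc 1 s, eLpNorm (fun x => ‖iteratedFDeriv ℝ k f x‖) 2 volume)
    + eLpNorm (fun x => ‖f x‖) 6 volume

section Sobolev

instance ContinuousMultilinearMap.finiteDimensional_real (n : ℕ) {E F : Type*}
    [NormedAddCommGroup E] [NormedSpace ℝ E] [FiniteDimensional ℝ E]
    [NormedAddCommGroup F] [NormedSpace ℝ F] [FiniteDimensional ℝ F] :
    FiniteDimensional ℝ (ContinuousMultilinearMap ℝ (fun _ : Fin n => E) F) :=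
  FiniteDimensional.of_injective
    (ContinuousMultilinearMap.toMultilinearMapLinear :
      ContinuousMultilinearMap ℝ (fun _ : Fin n => E) F →ₗ[ℝ] _)
    ContinuousMultilinearMap.toMultilinearMap_injective

/-- The Gagliardo-Nirenberg-Sobolev inequality `L² → L⁶` on `ℝ³`. -/
theorem exists_eLpNorm_six_le_eLpNorm_two_fderiv (F : Type*) [NormedAddCommGroup F]
    [NormedSpace ℝ F] [FiniteDimensional ℝ F] :
    ∃ C : ℝ≥0, ∀ w : EuclideanSpace ℝ (Fin 3) → F, ContDiff ℝ 1 w → HasCompactSupport w →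
      eLpNorm w 6 volume ≤ C * eLpNorm (fderiv ℝ w) 2 volume :=
  ⟨SNormLESNormFDerivOfEqConst F (volume : Measure (EuclideanSpace ℝ (Fin 3))) (2 : ℝ≥0),
    fun _ hw hc => eLpNorm_le_eLpNorm_fderiv_of_eq (p := 2) (p' := 6) volume hw hc
      (by norm_num) (by simp) (by simp; norm_num)⟩

theorem exists_eLpNorm_six_iteratedFDeriv_le (i : ℕ) :
    ∃ C : ℝ≥0, ∀ u : EuclideanSpace ℝ (Fin 3) → ℝ,
      ContDiff ℝ (⊤ : ℕ∞) u → HasCompactSupport u →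
      eLpNorm (iteratedFDeriv ℝ i u) 6 volume
        ≤ C * eLpNorm (iteratedFDeriv ℝ (i + 1) u) 2 volume := by
  obtain ⟨C, hC⟩ := exists_eLpNorm_six_le_eLpNorm_two_fderiv
    (ContinuousMultilinearMap ℝ (fun _ : Fin i => EuclideanSpace ℝ (Fin 3)) ℝ)
  refine ⟨C, fun u hu hc => (hC _ (hu.iteratedFDeriv_right (m := 1) (by exact_mod_cast le_top))
    (hc.iteratedFDeriv i)).trans_eq ?_⟩
  rw [eLpNorm_congr_norm_ae (.of_forall fun x => norm_fderiv_iteratedFDeriv)]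

/-- A common bound for the `L²` and `L⁶` norms also bounds the `L⁴` norm. -/
theorem eLpNorm_four_le_of_two_of_six {α F : Type*} [MeasurableSpace α] {μ : Measure α}
    [NormedAddCommGroup F] {f : α → F} (hf : AEStronglyMeasurable f μ) {A : ℝ≥0∞}
    (h2 : eLpNorm f 2 μ ≤ A) (h6 : eLpNorm f 6 μ ≤ A) : eLpNorm f 4 μ ≤ A := by
  have e2 := eLpNorm_nnreal_pow_eq_lintegral (f := f) (μ := μ) (p := 2) (by norm_num)
  have e4 := eLpNorm_nnreal_pow_eq_lintegral (f := f) (μ := μ) (p := 4) (by norm_num)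
  have e6 := eLpNorm_nnreal_pow_eq_lintegral (f := f) (μ := μ) (p := 6) (by norm_num)
  norm_num at e2 e4 e6
  have holder := ENNReal.lintegral_mul_norm_pow_le (μ := μ) (f := fun x => ‖f x‖ₑ ^ (2 : ℕ))
    (g := fun x => ‖f x‖ₑ ^ (6 : ℕ)) (hf.enorm.pow_const _) (hf.enorm.pow_const _)
    (p := 1 / 2) (q := 1 / 2) (by norm_num) (by norm_num) (by norm_num)
  have hint : ∀ x, (‖f x‖ₑ ^ (2 : ℕ)) ^ (1 / 2 : ℝ) * (‖f x‖ₑ ^ (6 : ℕ)) ^ (1 / 2 : ℝ)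
      = ‖f x‖ₑ ^ (4 : ℕ) := fun x => by
    rw [← ENNReal.rpow_natCast_mul, ← ENNReal.rpow_natCast_mul,
      ← ENNReal.rpow_add_of_nonneg _ _ (by norm_num) (by norm_num), ← ENNReal.rpow_natCast]
    norm_num
  simp only [hint] at holder
  rw [← e2, ← e4, ← e6] at holder
  rw [← ENNReal.pow_le_pow_left_iff (n := 4) (by norm_num)]
  refine holder.trans ?_
  calc _ ≤ (A ^ 2) ^ (1 / 2 : ℝ) * (A ^ 6) ^ (1 / 2 : ℝ) := by gcongr
    _ = A ^ 4 := by
      rw [← ENNReal.rpow_natCast_mul, ← ENNReal.rpow_natCast_mul,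
        ← ENNReal.rpow_add_of_nonneg _ _ (by norm_num) (by norm_num), ← ENNReal.rpow_natCast]
      norm_num

theorem eLpNorm_six_comp_add_smul {F : Type*} [NormedAddCommGroup F]
    {g : EuclideanSpace ℝ (Fin 3) → F} (hg : Continuous g) (x : EuclideanSpace ℝ (Fin 3))
    {r : ℝ} (hr : 0 < r) :
    eLpNorm (fun y => g (x + r • y)) 6 volume
      = ENNReal.ofReal (r ^ (-(1 / 2) : ℝ)) * eLpNorm g 6 volume := by
  have htrans : eLpNorm (fun z => g (x + z)) 6 volume = eLpNorm g 6 volume :=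
    eLpNorm_comp_measurePreserving (g := g) hg.aestronglyMeasurable
      (measurePreserving_add_left volume x)
  have hcont : Continuous fun z => g (x + z) := by fun_prop
  have hmap := eLpNorm_map_measure (p := 6) (g := fun z => g (x + z))
    (f := fun y : EuclideanSpace ℝ (Fin 3) => r • y) (μ := volume)
    hcont.aestronglyMeasurable (by fun_prop)
  rw [Measure.map_addHaar_smul volume hr.ne', eLpNorm_smul_measure_of_ne_top (by norm_num),
    htrans] at hmap
  change eLpNorm ((fun z => g (x + z)) ∘ fun y => r • y) 6 volume = _
  rw [← hmap, smul_eq_mul, ENNReal.ofReal_rpow_of_nonneg (by positivity) (by positivity)]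
  congr 2
  rw [abs_of_pos (by positivity), ← Real.rpow_natCast, ← Real.rpow_neg hr.le, ← Real.rpow_mul hr.le]
  norm_num

theorem enorm_le_enorm_add_lintegral_fderiv {E F : Type*}
    [NormedAddCommGroup E] [NormedSpace ℝ E] [NormedAddCommGroup F] [NormedSpace ℝ F]
    [CompleteSpace F] {u : E → F} (hu : ContDiff ℝ 1 u) (x : E) {y : E} (hy : ‖y‖ ≤ 1) :
    ‖u x‖ₑ ≤ ‖u (x + y)‖ₑ + ∫⁻ r in Set.Ioc (0 : ℝ) 1, ‖fderiv ℝ u (x + r • y)‖ₑ := by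
  have hd : Continuous (fderiv ℝ u) := hu.continuous_fderiv (by norm_num)
  have hderiv : ∀ r ∈ Set.uIcc (0 : ℝ) 1,
      HasDerivAt (fun r : ℝ => u (x + r • y)) (fderiv ℝ u (x + r • y) y) r := fun r _ => by
    have h1 : HasDerivAt (fun r : ℝ => x + r • y) y r := by
      simpa using ((hasDerivAt_id r).smul_const y).const_add x
    exact ((hu.differentiable (by norm_num)) _).hasFDerivAt.comp_hasDerivAt r h1
  have hftc := intervalIntegral.integral_eq_sub_of_hasDerivAt hderiv
    (Continuous.intervalIntegrable (by fun_prop) _ _)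
  simp only [one_smul, zero_smul, add_zero] at hftc
  have hux : u x = u (x + y) - ∫ r in (0 : ℝ)..1, fderiv ℝ u (x + r • y) y := by
    rw [hftc]; abel
  rw [hux]
  refine enorm_sub_le.trans (add_le_add le_rfl ?_)
  rw [intervalIntegral.integral_of_le zero_le_one]
  refine (enorm_integral_le_lintegral_enorm _).trans (lintegral_mono fun r => ?_)
  refine ((fderiv ℝ u (x + r • y)).le_opENorm y).trans ?_
  have : ‖y‖ₑ ≤ 1 := by
    rw [← ofReal_norm]; exact ENNReal.ofReal_le_one.2 hy
  exact (mul_le_mul_right this _).trans_eq (mul_one _)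

/-- Morrey's inequality on `ℝ³` with exponent `6`. -/
theorem exists_enorm_le_eLpNorm_six_add_fderiv :
    ∃ C : ℝ≥0, ∀ u : EuclideanSpace ℝ (Fin 3) → ℝ, ContDiff ℝ 1 u → ∀ x,
      ‖u x‖ₑ ≤ C * (eLpNorm u 6 volume + eLpNorm (fderiv ℝ u) 6 volume) := by
  set B : Set (EuclideanSpace ℝ (Fin 3)) := Metric.ball 0 1
  have hB0 : volume B ≠ 0 := (Metric.measure_ball_pos volume 0 one_pos).ne'
  have hBt : volume B ≠ ∞ := measure_ball_lt_top.ne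
  set K : ℝ≥0∞ := ∫⁻ r in Set.Ioc (0 : ℝ) 1, ENNReal.ofReal (r ^ (-(1 / 2) : ℝ))
  have hKt : K ≠ ∞ := by
    have hi := (intervalIntegral.intervalIntegrable_rpow' (a := 0) (b := 1)
      (r := -(1 / 2)) (by norm_num)).1
    exact hi.lintegral_lt_top.ne
  set V : ℝ≥0∞ := volume B ^ (5 / 6 : ℝ) with hV
  have hVt : V ≠ ∞ := ENNReal.rpow_ne_top_of_nonneg (by norm_num) hBt
  have hCt : (volume B)⁻¹ * (V * (1 + K)) ≠ ∞ := by finiteness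
  refine ⟨((volume B)⁻¹ * (V * (1 + K))).toNNReal, fun u hu x => ?_⟩
  rw [ENNReal.coe_toNNReal hCt]
  have hd : Continuous (fderiv ℝ u) := hu.continuous_fderiv (by norm_num)
  have hball : ∀ {F : Type} [NormedAddCommGroup F] (g : EuclideanSpace ℝ (Fin 3) → F),
      Continuous g → ∫⁻ y in B, ‖g y‖ₑ ≤ V * eLpNorm g 6 volume := fun g hg => by
    rw [← eLpNorm_one_eq_lintegral_enorm]
    refine (eLpNorm_le_eLpNorm_mul_rpow_measure_univ (q := 6) (by norm_num)
      hg.aestronglyMeasurable).trans ?_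
    rw [mul_comm, Measure.restrict_apply_univ]
    refine mul_le_mul' (le_of_eq ?_) (eLpNorm_mono_measure _ Measure.restrict_le_self)
    norm_num [hV]
  have hmain : volume B * ‖u x‖ₑ
      ≤ V * (1 + K) * (eLpNorm u 6 volume + eLpNorm (fderiv ℝ u) 6 volume) := by
    calc volume B * ‖u x‖ₑ = ∫⁻ _ in B, ‖u x‖ₑ := by simp [mul_comm]
      _ ≤ ∫⁻ y in B, (‖u (x + (1 : ℝ) • y)‖ₑ
            + ∫⁻ r in Set.Ioc (0 : ℝ) 1, ‖fderiv ℝ u (x + r • y)‖ₑ) := by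
          refine setLIntegral_mono' measurableSet_ball fun y hy => ?_
          rw [one_smul]
          exact enorm_le_enorm_add_lintegral_fderiv hu x (mem_ball_zero_iff.1 hy).le
      _ = (∫⁻ y in B, ‖u (x + (1 : ℝ) • y)‖ₑ)
            + ∫⁻ r in Set.Ioc (0 : ℝ) 1, ∫⁻ y in B, ‖fderiv ℝ u (x + r • y)‖ₑ := by
          have hcu := hu.continuous
          have hcx : Continuous fun y => u (x + (1 : ℝ) • y) := by fun_prop
          have hdx : Continuous fun q : EuclideanSpace ℝ (Fin 3) × ℝ =>
              fderiv ℝ u (x + q.2 • q.1) := by fun_prop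
          rw [lintegral_add_left hcx.enorm.measurable, lintegral_lintegral_swap]
          exact hdx.enorm.aemeasurable
      _ ≤ V * eLpNorm u 6 volume + ∫⁻ r in Set.Ioc (0 : ℝ) 1,
            ENNReal.ofReal (r ^ (-(1 / 2) : ℝ)) * (V * eLpNorm (fderiv ℝ u) 6 volume) := by
          have hcu := hu.continuous
          refine add_le_add ?_ (setLIntegral_mono' measurableSet_Ioc fun r hr => ?_)
          · refine (hball _ (by fun_prop)).trans_eq ?_
            rw [eLpNorm_six_comp_add_smul hu.continuous x one_pos]
            simp
          · refine (hball _ (by fun_prop)).trans_eq ?_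
            rw [eLpNorm_six_comp_add_smul hd x hr.1]
            ring
      _ = V * (eLpNorm u 6 volume + K * eLpNorm (fderiv ℝ u) 6 volume) := by
          rw [lintegral_mul_const _ (by fun_prop)]
          ring
      _ ≤ V * ((1 + K) * eLpNorm u 6 volume + (1 + K) * eLpNorm (fderiv ℝ u) 6 volume) := by
          gcongr
          · exact le_mul_of_one_le_left' le_self_add
          · exact le_add_self
      _ = _ := by ring
  calc ‖u x‖ₑ = (volume B)⁻¹ * (volume B * ‖u x‖ₑ) := by
        rw [← mul_assoc, ENNReal.inv_mul_cancel hB0 hBt, one_mul]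
    _ ≤ _ := by
        rw [mul_assoc]
        gcongr

end Sobolev

section RNorm

theorem eLpNorm_two_iteratedFDeriv_le_RNorm {s k : ℕ} (hk : 1 ≤ k) (hks : k ≤ s)
    (u : EuclideanSpace ℝ (Fin 3) → ℝ) :
    eLpNorm (iteratedFDeriv ℝ k u) 2 volume ≤ RNorm s u := by
  rw [← eLpNorm_norm]
  exact (Finset.single_le_sum
    (f := fun k => eLpNorm (fun x => ‖iteratedFDeriv ℝ k u x‖) 2 volume)
    (fun _ _ => zero_le) (Finset.mem_Icc.2 ⟨hk, hks⟩)).trans le_self_add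

theorem eLpNorm_six_le_RNorm (s : ℕ) (u : EuclideanSpace ℝ (Fin 3) → ℝ) :
    eLpNorm u 6 volume ≤ RNorm s u := by
  rw [← eLpNorm_norm]
  exact le_add_self

theorem exists_enorm_le_RNorm {s : ℕ} (hs : 2 ≤ s) :
    ∃ C : ℝ≥0, ∀ u : EuclideanSpace ℝ (Fin 3) → ℝ,
      ContDiff ℝ (⊤ : ℕ∞) u → HasCompactSupport u → ∀ x, ‖u x‖ₑ ≤ C * RNorm s u := by
  obtain ⟨C, hC⟩ := exists_enorm_le_eLpNorm_six_add_fderiv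
  obtain ⟨D, hD⟩ := exists_eLpNorm_six_iteratedFDeriv_le 1
  refine ⟨C * (1 + D), fun u hu hc x => (hC u (hu.of_le (by exact_mod_cast le_top)) x).trans ?_⟩
  have hfd : eLpNorm (fderiv ℝ u) 6 volume = eLpNorm (iteratedFDeriv ℝ 1 u) 6 volume :=
    eLpNorm_congr_norm_ae (.of_forall fun x => (norm_iteratedFDeriv_one u).symm)
  rw [hfd]
  push_cast
  rw [mul_assoc, add_mul, one_mul]
  gcongr
  · exact eLpNorm_six_le_RNorm s u
  · exact (hD u hu hc).trans
      (mul_le_mul_right (eLpNorm_two_iteratedFDeriv_le_RNorm one_le_two hs u) _)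

theorem exists_eLpNorm_four_iteratedFDeriv_le_RNorm (s : ℕ) :
    ∃ C : ℝ≥0, ∀ i, 1 ≤ i → i < s → ∀ u : EuclideanSpace ℝ (Fin 3) → ℝ,
      ContDiff ℝ (⊤ : ℕ∞) u → HasCompactSupport u →
      eLpNorm (iteratedFDeriv ℝ i u) 4 volume ≤ C * RNorm s u := by
  choose D hD using exists_eLpNorm_six_iteratedFDeriv_le
  refine ⟨1 + ∑ i ∈ Finset.range s, D i, fun i hi his u hu hc => ?_⟩
  have hDi : D i ≤ ∑ i ∈ Finset.range s, D i :=
    Finset.single_le_sum (fun _ _ => zero_le) (Finset.mem_range.2 his)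
  rw [← eLpNorm_norm]
  refine eLpNorm_four_le_of_two_of_six
    (hu.continuous_iteratedFDeriv (by exact_mod_cast le_top)).norm.aestronglyMeasurable ?_ ?_ <;>
    rw [eLpNorm_norm]
  · refine (eLpNorm_two_iteratedFDeriv_le_RNorm hi his.le u).trans ?_
    exact le_mul_of_one_le_left' (by exact_mod_cast le_self_add)
  · refine (hD i u hu hc).trans ?_
    gcongr
    · exact hDi.trans le_add_self
    · exact eLpNorm_two_iteratedFDeriv_le_RNorm (by omega) his u

theorem eLpNorm_mul_le_of_enorm_le {α : Type*} [MeasurableSpace α] {μ : Measure α}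
    {f g : α → ℝ} {A : ℝ≥0∞} (p : ℝ≥0∞) (hf : ∀ x, ‖f x‖ₑ ≤ A)
    (hg : AEStronglyMeasurable g μ) :
    eLpNorm (fun x => f x * g x) p μ ≤ A * eLpNorm g p μ := by
  refine (eLpNorm_smul_le_eLpNorm_top_mul_eLpNorm p hg f).trans ?_
  gcongr
  rw [eLpNorm_exponent_top]
  exact essSup_le_of_ae_le A (.of_forall hf)

/-- The Leibniz terms of order `1 ≤ k ≤ s` are bounded in `L²` by the `R^s` norms. -/
theorem exists_eLpNorm_two_mul_iteratedFDeriv_le {s : ℕ} (hs : 2 ≤ s) :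
    ∃ C : ℝ≥0, ∀ i j, 1 ≤ i + j → i + j ≤ s → ∀ u v : EuclideanSpace ℝ (Fin 3) → ℝ,
      ContDiff ℝ (⊤ : ℕ∞) u → HasCompactSupport u → ContDiff ℝ (⊤ : ℕ∞) v → HasCompactSupport v →
      eLpNorm (fun x => ‖iteratedFDeriv ℝ i u x‖ * ‖iteratedFDeriv ℝ j v x‖) 2 volume
        ≤ C * RNorm s u * RNorm s v := by
  obtain ⟨A, hA⟩ := exists_enorm_le_RNorm hs
  obtain ⟨B, hB⟩ := exists_eLpNorm_four_iteratedFDeriv_le_RNorm s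
  have hmeas : ∀ (n : ℕ) {w : EuclideanSpace ℝ (Fin 3) → ℝ}, ContDiff ℝ (⊤ : ℕ∞) w →
      AEStronglyMeasurable (fun x => ‖iteratedFDeriv ℝ n w x‖) volume := fun n w hw =>
    (hw.continuous_iteratedFDeriv (by exact_mod_cast le_top)).norm.aestronglyMeasurable
  -- the case where all derivatives fall on one factor
  have hzero : ∀ j, 1 ≤ j → j ≤ s → ∀ u v : EuclideanSpace ℝ (Fin 3) → ℝ,
      ContDiff ℝ (⊤ : ℕ∞) u → HasCompactSupport u → ContDiff ℝ (⊤ : ℕ∞) v →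
      eLpNorm (fun x => ‖iteratedFDeriv ℝ 0 u x‖ * ‖iteratedFDeriv ℝ j v x‖) 2 volume
        ≤ A * RNorm s u * RNorm s v := fun j hj hjs u v hu hcu hv => by
    refine (eLpNorm_mul_le_of_enorm_le 2 (A := A * RNorm s u) (fun x => ?_) (hmeas j hv)).trans ?_
    · rw [enorm_norm, ← ofReal_norm, norm_iteratedFDeriv_zero, ofReal_norm]
      exact hA u hu hcu x
    · rw [eLpNorm_norm]
      gcongr
      exact eLpNorm_two_iteratedFDeriv_le_RNorm hj hjs v
  refine ⟨A + B * B, fun i j h1 hle u v hu hcu hv hcv => ?_⟩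
  rcases Nat.eq_zero_or_pos i with rfl | hi
  · refine (hzero j (by omega) (by omega) u v hu hcu hv).trans ?_
    gcongr
    exact le_self_add
  rcases Nat.eq_zero_or_pos j with rfl | hj
  · simp_rw [mul_comm ‖iteratedFDeriv ℝ i u _‖]
    refine (hzero i (by omega) (by omega) v u hv hcv hu).trans ?_
    rw [mul_right_comm]
    gcongr
    exact le_self_add
  have : ENNReal.HolderTriple 4 4 2 := ⟨by
    rw [← two_mul, show (4 : ℝ≥0∞) = 2 * 2 by norm_num,
      ENNReal.mul_inv (by norm_num) (by norm_num), ← mul_assoc,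
      ENNReal.mul_inv_cancel (by norm_num) (by norm_num), one_mul]⟩
  refine (eLpNorm_smul_le_mul_eLpNorm (p := 4) (q := 4) (hmeas j hv) (hmeas i hu)).trans ?_
  rw [eLpNorm_norm, eLpNorm_norm]
  calc _ ≤ (B * RNorm s u) * (B * RNorm s v) :=
        mul_le_mul' (hB i hi (by omega) u hu hcu) (hB j hj (by omega) v hv hcv)
    _ = ((B * B : ℝ≥0) : ℝ≥0∞) * RNorm s u * RNorm s v := by push_cast; ring
    _ ≤ _ := by
      gcongr
      exact le_add_self

end RNorm

/-- For integer `s ≥ 2` there is a constant `C = C(s) > 0` such that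
`‖uv‖_{R^s} ≤ C ‖u‖_{R^s} ‖v‖_{R^s}` for all `u, v ∈ C₀^∞(ℝ³)`. -/
theorem stmt_14 (s : ℕ) (hs : 2 ≤ s) :
    ∃ C : ℝ≥0, 0 < C ∧ ∀ u v : EuclideanSpace ℝ (Fin 3) → ℝ,
      ContDiff ℝ (⊤ : ℕ∞) u → HasCompactSupport u → ContDiff ℝ (⊤ : ℕ∞) v → HasCompactSupport v →
      RNorm s (fun x => u x * v x) ≤ C * RNorm s u * RNorm s v := by
  obtain ⟨A, hA⟩ := exists_enorm_le_RNorm hs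
  obtain ⟨B, hB⟩ := exists_eLpNorm_two_mul_iteratedFDeriv_le hs
  set M : ℝ≥0 := ∑ k ∈ Finset.Icc 1 s, ∑ i ∈ Finset.range (k + 1), (k.choose i : ℝ≥0) * B with hM
  refine ⟨M + A + 1, by positivity, fun u v hu hcu hv hcv => ?_⟩
  have hL2 : ∀ k ∈ Finset.Icc 1 s,
      eLpNorm (fun x => ‖iteratedFDeriv ℝ k (fun x => u x * v x) x‖) 2 volume
        ≤ ∑ i ∈ Finset.range (k + 1), (k.choose i : ℝ≥0∞) * (B * RNorm s u * RNorm s v) := by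
    intro k hk
    rw [Finset.mem_Icc] at hk
    have hcont : ∀ (n : ℕ) {w : EuclideanSpace ℝ (Fin 3) → ℝ}, ContDiff ℝ (⊤ : ℕ∞) w →
        Continuous (fun x => ‖iteratedFDeriv ℝ n w x‖) := fun n w hw =>
      (hw.continuous_iteratedFDeriv (by exact_mod_cast le_top)).norm
    calc _ ≤ eLpNorm (∑ i ∈ Finset.range (k + 1), (k.choose i : ℝ) •
            fun x => ‖iteratedFDeriv ℝ i u x‖ * ‖iteratedFDeriv ℝ (k - i) v x‖) 2 volume := by
          refine eLpNorm_mono_real fun x => ?_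
          rw [norm_norm]
          refine (norm_iteratedFDeriv_mul_le hu hv x
            (n := k) (by exact_mod_cast le_top)).trans_eq ?_
          simp [mul_assoc]
      _ ≤ ∑ i ∈ Finset.range (k + 1), eLpNorm ((k.choose i : ℝ) •
            fun x => ‖iteratedFDeriv ℝ i u x‖ * ‖iteratedFDeriv ℝ (k - i) v x‖) 2 volume :=
          eLpNorm_sum_le (fun i _ => (((hcont i hu).mul
            (hcont (k - i) hv)).aestronglyMeasurable).const_smul _) (by norm_num)
      _ ≤ _ := by
          refine Finset.sum_le_sum fun i hi => ?_
          rw [Finset.mem_range] at hi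
          rw [eLpNorm_const_smul]
          refine mul_le_mul' (le_of_eq ?_)
            (hB i (k - i) (by omega) (by omega) u v hu hcu hv hcv)
          rw [← ofReal_norm, Real.norm_natCast, ENNReal.ofReal_natCast]
  have hL6 : eLpNorm (fun x => ‖u x * v x‖) 6 volume ≤ A * RNorm s u * RNorm s v := by
    rw [eLpNorm_norm]
    refine (eLpNorm_mul_le_of_enorm_le 6 (hA u hu hcu)
      hv.continuous.aestronglyMeasurable).trans ?_
    gcongr
    exact eLpNorm_six_le_RNorm s v
  calc RNorm s (fun x => u x * v x)
      ≤ (∑ k ∈ Finset.Icc 1 s, ∑ i ∈ Finset.range (k + 1),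
          (k.choose i : ℝ≥0∞) * (B * RNorm s u * RNorm s v)) + A * RNorm s u * RNorm s v :=
        add_le_add (Finset.sum_le_sum hL2) hL6
    _ = ((M + A : ℝ≥0) : ℝ≥0∞) * RNorm s u * RNorm s v := by
        rw [hM]
        push_cast
        simp only [add_mul, Finset.sum_mul, mul_assoc]
    _ ≤ _ := by
        gcongr ?_ * _ * _
        exact_mod_cast le_self_add
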